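/- Let X be a smooth vector field on ℝⁿ admitting a Jacobi multiplier R, and let Y be a smooth vector field with [Y,X] = h·X for some smooth function h : ℝⁿ → ℝ. Then the function I = div Y + Y(log R) + h is a first integral of X, i.e. X(div Y + Y(log R) + h) = 0 identically. -/

import Mathlib

/-- The divergence of a vector field on ℝⁿ: the trace of its Fréchet derivative. -/
noncomputable def vdiv {n : ℕ} (X : (Fin n → ℝ) → (Fin n → ℝ)) (x : Fin n → ℝ) : ℝ :=
  LinearMap.trace ℝ (Fin n → ℝ) (fderiv ℝ X x : (Fin n → ℝ) →ₗ[ℝ] (Fin n → ℝ))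

/-- The Lie bracket of vector fields: [X,Y](x) = DY(x)(X(x)) − DX(x)(Y(x)). -/
noncomputable def lieBracket {n : ℕ} (X Y : (Fin n → ℝ) → (Fin n → ℝ))
    (x : Fin n → ℝ) : Fin n → ℝ :=
  fderiv ℝ Y x (X x) - fderiv ℝ X x (Y x)

/-- The trace as a continuous linear functional. -/
noncomputable def trCLM (n : ℕ) : ((Fin n → ℝ) →L[ℝ] (Fin n → ℝ)) →L[ℝ] ℝ :=
  LinearMap.toContinuousLinearMap
    ((LinearMap.trace ℝ (Fin n → ℝ)) ∘ₗ (ContinuousLinearMap.coeLM ℝ))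

theorem trCLM_apply {n : ℕ} (A : (Fin n → ℝ) →L[ℝ] (Fin n → ℝ)) :
    trCLM n A = LinearMap.trace ℝ (Fin n → ℝ) (A : (Fin n → ℝ) →ₗ[ℝ] (Fin n → ℝ)) := rfl

theorem trCLM_comp_comm {n : ℕ} (A B : (Fin n → ℝ) →L[ℝ] (Fin n → ℝ)) :
    trCLM n (A.comp B) = trCLM n (B.comp A) := by
  rw [trCLM_apply, trCLM_apply]
  exact LinearMap.trace_mul_comm ℝ (A : (Fin n → ℝ) →ₗ[ℝ] (Fin n → ℝ)) B

theorem trCLM_smulRight {n : ℕ} (f : (Fin n → ℝ) →L[ℝ] ℝ) (v : Fin n → ℝ) :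
    trCLM n (f.smulRight v) = f v := by
  rw [trCLM_apply]
  exact LinearMap.trace_smulRight (f : (Fin n → ℝ) →ₗ[ℝ] ℝ) v

theorem fderiv_fderiv_symm {n : ℕ} {F : Type*} [NormedAddCommGroup F] [NormedSpace ℝ F]
    {f : (Fin n → ℝ) → F} (hf : ContDiff ℝ (⊤ : ℕ∞) f) (x v w : Fin n → ℝ) :
    fderiv ℝ (fderiv ℝ f) x v w = fderiv ℝ (fderiv ℝ f) x w v := by
  have h1 : IsSymmSndFDerivAt ℝ f x := by
    apply ContDiffAt.isSymmSndFDerivAt (n := 2)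
    · exact (contDiff_infty.1 hf 2).contDiffAt
    · simp
  exact h1 v w

theorem hasFDerivAt_fderiv_top {n : ℕ} {F : Type*} [NormedAddCommGroup F] [NormedSpace ℝ F]
    {f : (Fin n → ℝ) → F} (hf : ContDiff ℝ (⊤ : ℕ∞) f) (x : Fin n → ℝ) :
    HasFDerivAt (fderiv ℝ f) (fderiv ℝ (fderiv ℝ f) x) x := by
  have h1 : ContDiff ℝ 1 (fderiv ℝ f) :=
    (contDiff_infty.1 hf 2).fderiv_right (by norm_num)
  exact (h1.differentiable (by simp) x).hasFDerivAt

/-- If `X` is a smooth vector field on ℝⁿ admitting a Jacobi multiplier `R`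
(`R` smooth and positive with `X(R) + R·div X = 0`) and `Y` is a smooth vector field with
`[Y,X] = h·X` for some smooth `h`, then `I = div Y + Y(log R) + h` is a first integral of `X`. -/
theorem stmt_4 {n : ℕ} (X Y : (Fin n → ℝ) → (Fin n → ℝ))
    (R : (Fin n → ℝ) → ℝ) (h : (Fin n → ℝ) → ℝ)
    (hX : ContDiff ℝ (⊤ : ℕ∞) X) (hY : ContDiff ℝ (⊤ : ℕ∞) Y) (hR : ContDiff ℝ (⊤ : ℕ∞) R) (hh : ContDiff ℝ (⊤ : ℕ∞) h)
    (hRpos : ∀ x, 0 < R x)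
    (hJacobi : ∀ x, fderiv ℝ R x (X x) + R x * vdiv X x = 0)
    (hnorm : ∀ x, lieBracket Y X x = h x • X x) :
    ∀ x : Fin n → ℝ,
      fderiv ℝ (fun y => vdiv Y y + fderiv ℝ (fun z => Real.log (R z)) y (Y y) + h y)
        x (X x) = 0 := by
  intro x
  have hL : ContDiff ℝ (⊤ : ℕ∞) (fun z => Real.log (R z)) := hR.log (fun z => (hRpos z).ne')
  have hne : ((⊤ : ℕ∞) : WithTop ℕ∞) ≠ 0 := by simp
  have dX := (hX.differentiable hne x).hasFDerivAt
  have dY := (hY.differentiable hne x).hasFDerivAt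
  have dh := (hh.differentiable hne x).hasFDerivAt
  have ddX := hasFDerivAt_fderiv_top hX x
  have ddY := hasFDerivAt_fderiv_top hY x
  have ddL := hasFDerivAt_fderiv_top hL x
  have hLX : ∀ y, fderiv ℝ (fun z => Real.log (R z)) y (X y) = - trCLM n (fderiv ℝ X y) := by
    intro y
    have hy := (hR.differentiable hne y).hasFDerivAt.log (hRpos y).ne'
    rw [hy.fderiv, trCLM_apply]
    have h1 := hJacobi y
    have h2 := (hRpos y).ne'
    unfold vdiv at h1
    simp only [_root_.smul_apply, smul_eq_mul]
    field_simp
    linarith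
  set L := fun z => Real.log (R z) with hLdef
  have symX := fderiv_fderiv_symm hX x
  have symY := fderiv_fderiv_symm hY x
  have symL := fderiv_fderiv_symm hL x (X x) (Y x)
  -- derivative of the Jacobi relation along Y
  have e1 : fderiv ℝ (fderiv ℝ L) x (Y x) (X x) + fderiv ℝ L x (fderiv ℝ X x (Y x))
      = - trCLM n (fderiv ℝ (fderiv ℝ X) x (Y x)) := by
    have a := ddL.clm_apply dX
    have b := ((trCLM n).hasFDerivAt.comp x ddX).neg
    have c := a.unique (b.congr_of_eventuallyEq (Filter.Eventually.of_forall hLX))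
    have d := congrArg (fun A => A (Y x)) c
    simp at d
    linarith
  -- derivative of the bracket relation
  have e2 : fderiv ℝ (fderiv ℝ X) x (Y x) + (fderiv ℝ X x).comp (fderiv ℝ Y x)
      - fderiv ℝ (fderiv ℝ Y) x (X x) - (fderiv ℝ Y x).comp (fderiv ℝ X x)
      = (fderiv ℝ h x).smulRight (X x) + h x • fderiv ℝ X x := by
    have a := (ddX.clm_apply dY).sub (ddY.clm_apply dX)
    have b := dh.smul dX
    have c := a.unique (b.congr_of_eventuallyEq (Filter.Eventually.of_forall hnorm))
    ext1 w
    have d := congrArg (fun A => A w) c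
    simp at d
    simp only [_root_.sub_apply, _root_.add_apply,
      ContinuousLinearMap.comp_apply, _root_.smul_apply,
      ContinuousLinearMap.smulRight_apply]
    rw [symX (Y x) w, symY (X x) w, add_comm (fderiv ℝ h x w • X x), ← d]
    abel
  have e3 := congrArg (trCLM n) e2
  simp only [map_add, map_sub, map_smul, trCLM_smulRight, smul_eq_mul] at e3
  rw [trCLM_comp_comm (fderiv ℝ X x)] at e3
  have e4 := congrArg (fderiv ℝ L x) (hnorm x)
  simp only [lieBracket, map_sub, map_smul, smul_eq_mul] at e4
  rw [hLX x] at e4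
  have g := (((trCLM n).hasFDerivAt.comp x ddY).add (ddL.clm_apply dY)).add dh
  have g' : fderiv ℝ (fun y => vdiv Y y + fderiv ℝ L y (Y y) + h y) x = _ := g.fderiv
  rw [g']
  simp
  linarith
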